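/- arXiv:2412.18122 — 8 statements merged into one kernel-verified Lean document; each statement's English description precedes it below -/
import Mathlib

section
/- Let M1 ≥ 1, M2 ≥ 1, N2 ≥ 1, N3 ≥ 1 be integers and let S = S1 ∪ S2 ∪ S3 be the sensor position set of the FOGNA with these parameters, with E1 = 2M1 + (M1+1)(M2−1) and E2 = 2E1 + N2(2E1+1). Then the FOECA of the FOGNA is hole-free over its central segment: every integer μ with |μ| ≤ (2N3+1)·E2 belongs to Φ^u(S) = Φ1(S) ∪ Φ2(S) ∪ Φ3(S). In particular the FOECA contains at least 2(2N3+1)(2E1 + N2(2E1+1)) + 1 consecutive lags. -/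
/-- Fourth-order co-array set Φ1(S) = {a+b+c−d : a,b,c,d ∈ S}. -/
def Phi1 (S : Set ℤ) : Set ℤ := {x | ∃ a ∈ S, ∃ b ∈ S, ∃ c ∈ S, ∃ d ∈ S, x = a + b + c - d}

/-- Fourth-order co-array set Φ2(S) = {a−b+c−d : a,b,c,d ∈ S}. -/
def Phi2 (S : Set ℤ) : Set ℤ := {x | ∃ a ∈ S, ∃ b ∈ S, ∃ c ∈ S, ∃ d ∈ S, x = a - b + c - d}

/-- Fourth-order co-array set Φ3(S) = {−a−b−c+d : a,b,c,d ∈ S}. -/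
def Phi3 (S : Set ℤ) : Set ℤ := {x | ∃ a ∈ S, ∃ b ∈ S, ∃ c ∈ S, ∃ d ∈ S, x = -a - b - c + d}

/-- FOECA position set Φ^u(S) = Φ1(S) ∪ Φ2(S) ∪ Φ3(S). -/
def PhiU (S : Set ℤ) : Set ℤ := Phi1 S ∪ Phi2 S ∪ Phi3 S

/-- Concatenated nested array (CNA) with parameters M1, M2. -/
def CNA (M1 M2 : ℤ) : Set ℤ :=
  Set.Icc 0 (M1 - 1) ∪
  {x | ∃ k, 0 ≤ k ∧ k ≤ M2 - 1 ∧ x = M1 + k * (M1 + 1)} ∪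
  {x | ∃ j, 1 ≤ j ∧ j ≤ M1 ∧ x = M1 + (M1 + 1) * (M2 - 1) + j}

theorem zero_mem_CNA {M1 M2 : ℤ} (hM1 : 1 ≤ M1) : 0 ∈ CNA M1 M2 :=
  Or.inl (Or.inl ⟨le_rfl, by omega⟩)

theorem mem_CNA_of_mem_Icc {M1 M2 x : ℤ} (hM2 : 1 ≤ M2) (h0 : 0 ≤ x) (hx : x ≤ M1) :
    x ∈ CNA M1 M2 := by
  rcases hx.lt_or_eq with h | rfl
  · exact Or.inl (Or.inl ⟨h0, by omega⟩)
  · exact Or.inl (Or.inr ⟨0, le_rfl, by omega, by ring⟩)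

/-- The concatenated nested array is symmetric about its midpoint. -/
theorem sub_mem_CNA {M1 M2 x : ℤ} (hx : x ∈ CNA M1 M2) :
    2 * M1 + (M1 + 1) * (M2 - 1) - x ∈ CNA M1 M2 := by
  rcases hx with (⟨h0, h1⟩ | ⟨k, h0, h1, rfl⟩) | ⟨j, h0, h1, rfl⟩
  · exact Or.inr ⟨M1 - x, by omega, by omega, by ring⟩
  · exact Or.inl (Or.inr ⟨M2 - 1 - k, by omega, by omega, by ring⟩)
  · refine Or.inl (Or.inl ⟨?_, ?_⟩) <;> linarith

theorem exists_add_eq_of_le_max_CNA {M1 M2 n : ℤ} (hM1 : 1 ≤ M1) (hM2 : 1 ≤ M2) (h0 : 0 ≤ n)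
    (hn : n ≤ 2 * M1 + (M1 + 1) * (M2 - 1)) :
    ∃ a ∈ CNA M1 M2, ∃ b ∈ CNA M1 M2, n = a + b := by
  rcases lt_or_ge n M1 with h | h
  · exact ⟨n, mem_CNA_of_mem_Icc hM2 h0 h.le, 0, zero_mem_CNA hM1, by ring⟩
  · have hm : 0 < M1 + 1 := by omega
    have hq : (n - M1) / (M1 + 1) < M2 := Int.ediv_lt_of_lt_mul hm (by linarith)
    have hr := Int.emod_lt_of_pos (n - M1) hm
    exact ⟨M1 + (n - M1) / (M1 + 1) * (M1 + 1),
      Or.inl (Or.inr ⟨_, Int.ediv_nonneg (by omega) hm.le, by omega, rfl⟩),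
      (n - M1) % (M1 + 1),
      mem_CNA_of_mem_Icc hM2 (Int.emod_nonneg _ hm.ne') (by omega),
      by linarith [Int.mul_ediv_add_emod (n - M1) (M1 + 1)]⟩

/-- The sum co-array of the concatenated nested array is hole-free. -/
theorem exists_add_eq_CNA {M1 M2 E n : ℤ} (hM1 : 1 ≤ M1) (hM2 : 1 ≤ M2)
    (hE : E = 2 * M1 + (M1 + 1) * (M2 - 1)) (h0 : 0 ≤ n) (hn : n ≤ 2 * E) :
    ∃ a ∈ CNA M1 M2, ∃ b ∈ CNA M1 M2, n = a + b := by
  subst hE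
  rcases le_total n (2 * M1 + (M1 + 1) * (M2 - 1)) with h | h
  · exact exists_add_eq_of_le_max_CNA hM1 hM2 h0 h
  · obtain ⟨a, ha, b, hb, hab⟩ := exists_add_eq_of_le_max_CNA hM1 hM2
      (n := 2 * (2 * M1 + (M1 + 1) * (M2 - 1)) - n) (by linarith) (by linarith)
    exact ⟨_, sub_mem_CNA ha, _, sub_mem_CNA hb, by linarith⟩

theorem neg_mem_PhiU {S : Set ℤ} {x : ℤ} (hx : x ∈ PhiU S) : -x ∈ PhiU S := by
  rcases hx with (⟨a, ha, b, hb, c, hc, d, hd, rfl⟩ | ⟨a, ha, b, hb, c, hc, d, hd, rfl⟩) |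
    ⟨a, ha, b, hb, c, hc, d, hd, rfl⟩
  · exact Or.inr ⟨a, ha, b, hb, c, hc, d, hd, by ring⟩
  · exact Or.inl (Or.inr ⟨b, hb, a, ha, d, hd, c, hc, by ring⟩)
  · exact Or.inl (Or.inl ⟨a, ha, b, hb, c, hc, d, hd, by ring⟩)

/-- If all of `[0, 2E]` are sums of two elements of `S`, then translates of the co-array by an
element of `S` fill the segment of radius `2E + N(2E+1)` around that element. -/
theorem add_mem_PhiU {S : Set ℤ} {E N s r : ℤ} (hE : 0 ≤ E) (h0 : 0 ∈ S)
    (hadd : ∀ n, 0 ≤ n → n ≤ 2 * E → ∃ a ∈ S, ∃ b ∈ S, n = a + b)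
    (hT : ∀ i, 1 ≤ i → i ≤ N → 2 * E + i * (2 * E + 1) ∈ S) (hs : s ∈ S)
    (hr : |r| ≤ 2 * E + N * (2 * E + 1)) : s + r ∈ PhiU S := by
  have hw : 0 < 2 * E + 1 := by omega
  have key : ∃ t ∈ S, ∃ a ∈ S, ∃ b ∈ S, |r| = t - a - b ∨ |r| = a + b - t ∧ t = 0 := by
    rcases le_or_gt |r| (2 * E) with h | h
    · obtain ⟨a, ha, b, hb, hab⟩ := hadd |r| (abs_nonneg r) h
      exact ⟨0, h0, a, ha, b, hb, Or.inr ⟨by linarith, rfl⟩⟩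
    · have hlt := Int.emod_lt_of_pos |r| hw
      have hnn := Int.emod_nonneg |r| hw.ne'
      have hdm := Int.mul_ediv_add_emod |r| (2 * E + 1)
      have h1 : 1 ≤ |r| / (2 * E + 1) := (Int.le_ediv_iff_mul_le hw).2 (by linarith)
      have h2 : |r| / (2 * E + 1) < N + 1 := Int.ediv_lt_of_lt_mul hw (by linarith)
      obtain ⟨a, ha, b, hb, hab⟩ := hadd (2 * E - |r| % (2 * E + 1)) (by omega) (by omega)
      exact ⟨_, hT _ h1 (by omega), a, ha, b, hb, Or.inl (by linarith)⟩
  obtain ⟨t, ht, a, ha, b, hb, h⟩ := key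
  have hφ : r = t - a - b ∨ r = a + b - t := by
    rcases abs_choice r with hr' | hr' <;> rw [hr'] at h <;> omega
  rcases hφ with rfl | rfl
  · exact Or.inl (Or.inr ⟨s, hs, a, ha, t, ht, b, hb, by ring⟩)
  · exact Or.inl (Or.inl ⟨s, hs, a, ha, b, hb, t, ht, by ring⟩)

/-- The FOECA of the FOGNA is hole-free over its central segment: every integer μ with
`|μ| ≤ (2N3+1)·E2` belongs to Φ^u(S); in particular the FOECA contains at least
`2(2N3+1)(2E1+N2(2E1+1))+1` consecutive lags. -/
theorem fogna_foeca_hole_free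
    (M1 M2 N2 N3 : ℤ) (hM1 : 1 ≤ M1) (hM2 : 1 ≤ M2) (hN2 : 1 ≤ N2) (hN3 : 1 ≤ N3)
    (E1 E2 : ℤ) (hE1 : E1 = 2 * M1 + (M1 + 1) * (M2 - 1))
    (hE2 : E2 = 2 * E1 + N2 * (2 * E1 + 1))
    (S : Set ℤ)
    (hS : S = CNA M1 M2 ∪
      {x | ∃ i, 1 ≤ i ∧ i ≤ N2 ∧ x = 2 * E1 + i * (2 * E1 + 1)} ∪
      {x | ∃ i, 1 ≤ i ∧ i ≤ N3 ∧ x = 2 * i * E2}) :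
    ∀ μ : ℤ, |μ| ≤ (2 * N3 + 1) * E2 → μ ∈ PhiU S := by
  have hE1nn : 0 ≤ E1 := by
    rw [hE1]; exact add_nonneg (by omega) (mul_nonneg (by omega) (by omega))
  have hE2pos : 0 < 2 * E2 := by
    have : 0 < N2 * (2 * E1 + 1) := mul_pos (by omega) (by omega)
    omega
  have hC : CNA M1 M2 ⊆ S := fun x hx => hS ▸ Or.inl (Or.inl hx)
  have h0 : 0 ∈ S := hC (zero_mem_CNA hM1)
  have hadd : ∀ n, 0 ≤ n → n ≤ 2 * E1 → ∃ a ∈ S, ∃ b ∈ S, n = a + b := fun n hn hn' => by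
    obtain ⟨a, ha, b, hb, hab⟩ := exists_add_eq_CNA hM1 hM2 hE1 hn hn'
    exact ⟨a, hC ha, b, hC hb, hab⟩
  have hT : ∀ i, 1 ≤ i → i ≤ N2 → 2 * E1 + i * (2 * E1 + 1) ∈ S := fun i hi hi' =>
    hS ▸ Or.inl (Or.inr ⟨i, hi, hi', rfl⟩)
  have hU : ∀ k, 0 ≤ k → k ≤ N3 → 2 * k * E2 ∈ S := fun k hk hk' => by
    rcases hk.eq_or_lt with rfl | hk
    · simpa using h0
    · exact hS ▸ Or.inr ⟨k, hk, hk', rfl⟩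
  have hpos : ∀ ν, 0 ≤ ν → ν ≤ (2 * N3 + 1) * E2 → ν ∈ PhiU S := fun ν hν hν' => by
    obtain ⟨k, hk, hk', hr⟩ : ∃ k, 0 ≤ k ∧ k ≤ N3 ∧ |ν - 2 * k * E2| ≤ E2 := by
      rcases lt_or_ge ν (2 * N3 * E2) with h | h
      · have hlt := Int.emod_lt_of_pos (ν + E2) hE2pos
        have hnn := Int.emod_nonneg (ν + E2) hE2pos.ne'
        have hdm := Int.mul_ediv_add_emod (ν + E2) (2 * E2)
        refine ⟨(ν + E2) / (2 * E2), Int.ediv_nonneg (by omega) hE2pos.le, ?_, ?_⟩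
        · exact Int.lt_add_one_iff.1 (Int.ediv_lt_of_lt_mul hE2pos (by linarith))
        · rw [abs_le]; constructor <;> linarith
      · exact ⟨N3, by omega, le_rfl, by rw [abs_le]; constructor <;> linarith⟩
    have := add_mem_PhiU hE1nn h0 hadd hT (hU k hk hk') (hr.trans_eq hE2)
    rwa [add_sub_cancel] at this
  intro μ hμ
  rcases le_total 0 μ with h | h
  · exact hpos μ h ((le_abs_self μ).trans hμ)
  · simpa using neg_mem_PhiU (hpos (-μ) (by omega) ((neg_le_abs μ).trans hμ))
end

section
/- Let M1 ≥ 1 and M2 ≥ 1 be integers, and let S1 = {0,1,…,M1−1} ∪ {M1 + k(M1+1) : 0 ≤ k ≤ M2−1} ∪ {M1 + (M1+1)(M2−1) + j : 1 ≤ j ≤ M1} be the sensor set of the concatenated nested array (CNA) with aperture E1 = 2M1 + (M1+1)(M2−1). Then the sum co-array of the CNA is hole-free: {a + b : a, b ∈ S1} = {0, 1, …, 2E1}. -/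
theorem CNA.initial_mem {M1 M2 r : ℤ} (hM2 : 1 ≤ M2) (h0 : 0 ≤ r) (hr : r ≤ M1) :
    r ∈ CNA M1 M2 := by
  rcases hr.lt_or_eq with h | h
  · exact Or.inl (Or.inl ⟨h0, by omega⟩)
  · exact Or.inl (Or.inr ⟨0, le_rfl, by omega, by simp [h]⟩)

theorem CNA.middle_mem {M1 M2 k : ℤ} (h0 : 0 ≤ k) (hk : k ≤ M2 - 1) :
    M1 + k * (M1 + 1) ∈ CNA M1 M2 :=
  Or.inl (Or.inr ⟨k, h0, hk, rfl⟩)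

theorem CNA.final_mem {M1 M2 r : ℤ} (hM2 : 1 ≤ M2) (h0 : 0 ≤ r) (hr : r ≤ M1) :
    M1 + (M1 + 1) * (M2 - 1) + r ∈ CNA M1 M2 := by
  rcases h0.lt_or_eq with h | h
  · exact Or.inr ⟨r, h, hr, rfl⟩
  · exact Or.inl (Or.inr ⟨M2 - 1, by omega, le_rfl, by rw [← h]; ring⟩)

theorem CNA.subset_Icc {M1 M2 : ℤ} (hM1 : 1 ≤ M1) (hM2 : 1 ≤ M2) :
    CNA M1 M2 ⊆ Set.Icc 0 (2 * M1 + (M1 + 1) * (M2 - 1)) := by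
  have hD : 0 ≤ (M1 + 1) * (M2 - 1) := mul_nonneg (by omega) (by omega)
  rintro x ((⟨h0, h1⟩ | ⟨k, h0, h1, rfl⟩) | ⟨j, h0, h1, rfl⟩)
  · exact ⟨h0, by omega⟩
  · have hk : 0 ≤ k * (M1 + 1) := mul_nonneg h0 (by omega)
    have hk' : k * (M1 + 1) ≤ (M2 - 1) * (M1 + 1) :=
      mul_le_mul_of_nonneg_right h1 (by omega)
    constructor <;> linarith
  · constructor <;> linarith

/-- Division with remainder by `M1 + 1`, with the quotient bounded by `M2 - 1`. -/
theorem exists_eq_mul_add_of_le {M1 M2 y : ℤ} (hM1 : 1 ≤ M1) (h0 : 0 ≤ y)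
    (hy : y ≤ M1 + (M1 + 1) * (M2 - 1)) :
    ∃ k r, 0 ≤ k ∧ k ≤ M2 - 1 ∧ 0 ≤ r ∧ r ≤ M1 ∧ y = k * (M1 + 1) + r := by
  have hpos : 0 < M1 + 1 := by omega
  refine ⟨y / (M1 + 1), y % (M1 + 1), Int.ediv_nonneg h0 hpos.le, ?_,
    Int.emod_nonneg _ hpos.ne', Int.lt_add_one_iff.mp (Int.emod_lt_of_pos _ hpos), ?_⟩
  · have : y / (M1 + 1) < M2 := Int.ediv_lt_of_lt_mul hpos (by linarith)
    omega
  · exact (Int.ediv_mul_add_emod y (M1 + 1)).symm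

/-- The sum co-array of the CNA (aperture `E1 = 2M1 + (M1+1)(M2−1)`) is hole-free:
`{a + b : a, b ∈ S1} = {0, 1, …, 2E1}`. -/
theorem cna_sum_coarray_hole_free (M1 M2 : ℤ) (hM1 : 1 ≤ M1) (hM2 : 1 ≤ M2) :
    {x : ℤ | ∃ a ∈ CNA M1 M2, ∃ b ∈ CNA M1 M2, x = a + b} =
      Set.Icc 0 (2 * (2 * M1 + (M1 + 1) * (M2 - 1))) := by
  ext x
  constructor
  · rintro ⟨a, ha, b, hb, rfl⟩
    obtain ⟨ha0, ha1⟩ := CNA.subset_Icc hM1 hM2 ha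
    obtain ⟨hb0, hb1⟩ := CNA.subset_Icc hM1 hM2 hb
    constructor <;> linarith
  · rintro ⟨h0, h1⟩
    rcases lt_or_ge x M1 with hx | hx
    · exact ⟨x, CNA.initial_mem hM2 h0 hx.le, 0,
        CNA.initial_mem hM2 le_rfl (by omega), by ring⟩
    rcases le_or_gt x (2 * M1 + (M1 + 1) * (M2 - 1)) with hE | hE
    · obtain ⟨k, r, hk0, hk, hr0, hr, h⟩ :=
        exists_eq_mul_add_of_le (M2 := M2) (y := x - M1) hM1 (by omega) (by linarith)
      exact ⟨_, CNA.middle_mem hk0 hk, r, CNA.initial_mem hM2 hr0 hr, by linarith⟩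
    rcases le_or_gt x (3 * M1 + 2 * ((M1 + 1) * (M2 - 1))) with hF | hF
    · obtain ⟨k, r, hk0, hk, hr0, hr, h⟩ :=
        exists_eq_mul_add_of_le (M2 := M2) (y := x - (2 * M1 + (M1 + 1) * (M2 - 1)))
          hM1 (by linarith) (by linarith)
      exact ⟨_, CNA.middle_mem hk0 hk, _, CNA.final_mem hM2 hr0 hr, by linarith⟩
    · exact ⟨_, CNA.final_mem hM2 (by omega) le_rfl, _,
        CNA.final_mem (r := x - (3 * M1 + 2 * ((M1 + 1) * (M2 - 1)))) hM2
          (by linarith) (by linarith), by ring⟩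
end

section
/- Let E1 ≥ 1 and N2 ≥ 1 be integers, V1 = {0, 1, …, 2E1}, and S2 = {2E1 + i(2E1+1) : 1 ≤ i ≤ N2}. Then the two cross-difference sets are full integer intervals: {v − s : v ∈ V1, s ∈ S2} = {μ ∈ ℤ : −2E1 − N2(2E1+1) ≤ μ ≤ −2E1 − 1} and {s − v : v ∈ V1, s ∈ S2} = {μ ∈ ℤ : 2E1 + 1 ≤ μ ≤ 2E1 + N2(2E1+1)}. -/
/-- Subtracting `{0,…,k}` from the progression `{k + i(k+1) : 1 ≤ i ≤ n}` yields exactly the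
integers from `k + 1` to `k + n(k+1)`, by division with remainder by `k + 1`. -/
theorem exists_progression_sub_iff {k : ℤ} (hk : 0 ≤ k) (n x : ℤ) :
    (∃ v ∈ Set.Icc 0 k, ∃ s ∈ {y | ∃ i, 1 ≤ i ∧ i ≤ n ∧ y = k + i * (k + 1)}, x = s - v) ↔
      x ∈ Set.Icc (k + 1) (k + n * (k + 1)) := by
  constructor
  · rintro ⟨v, ⟨hv0, hvk⟩, _, ⟨i, hi1, hin, rfl⟩, rfl⟩
    constructor <;> nlinarith
  · rintro ⟨hlo, hhi⟩
    have hpos : 0 < k + 1 := by omega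
    have hmod0 := Int.emod_nonneg x hpos.ne'
    have hmod := Int.emod_lt_of_pos x hpos
    have hdiv := Int.mul_ediv_add_emod x (k + 1)
    refine ⟨k - x % (k + 1), ⟨by omega, by omega⟩, _, ⟨x / (k + 1), ?_, ?_, rfl⟩, by linarith⟩
    · exact (Int.le_ediv_iff_mul_le hpos).2 (by omega)
    · exact Int.lt_add_one_iff.1 ((Int.ediv_lt_iff_lt_mul hpos).2 (by linarith))

/-- The two cross-difference sets between `V1 = {0,…,2E1}` and
`S2 = {2E1 + i(2E1+1) : 1 ≤ i ≤ N2}` are full integer intervals. -/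
theorem cross_difference_intervals (E1 N2 : ℤ) (hE1 : 1 ≤ E1) (hN2 : 1 ≤ N2)
    (V1 S2 : Set ℤ) (hV1 : V1 = Set.Icc 0 (2 * E1))
    (hS2 : S2 = {x | ∃ i, 1 ≤ i ∧ i ≤ N2 ∧ x = 2 * E1 + i * (2 * E1 + 1)}) :
    {x : ℤ | ∃ v ∈ V1, ∃ s ∈ S2, x = v - s} =
        Set.Icc (-(2 * E1) - N2 * (2 * E1 + 1)) (-(2 * E1) - 1) ∧
    {x : ℤ | ∃ v ∈ V1, ∃ s ∈ S2, x = s - v} =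
        Set.Icc (2 * E1 + 1) (2 * E1 + N2 * (2 * E1 + 1)) := by
  subst hV1 hS2
  have key := exists_progression_sub_iff (k := 2 * E1) (by omega) N2
  refine ⟨?_, Set.ext key⟩
  ext x
  have neg_mem := key (-x)
  simp only [Set.mem_ofPred_eq, neg_eq_iff_eq_neg, neg_sub] at neg_mem ⊢
  rw [neg_mem, Set.mem_Icc, Set.mem_Icc]
  constructor <;> rintro ⟨hlo, hhi⟩ <;> constructor <;> linarith
end

section
/- Let E1 ≥ 1 and N2 ≥ 1 be integers and set E2 = 2E1 + N2(2E1+1). Let V2 = {0, 1, …, 2E1} ∪ {2E1 + i(2E1+1) : 1 ≤ i ≤ N2}. Then the difference co-array of V2 is the full hole-free range {a − b : a, b ∈ V2} = {μ ∈ ℤ : −E2 ≤ μ ≤ E2}. -/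
/-- The difference co-array of `V2 = {0,…,2E1} ∪ {2E1 + i(2E1+1) : 1 ≤ i ≤ N2}` is the full
hole-free range `{−E2,…,E2}` with `E2 = 2E1 + N2(2E1+1)`. -/
theorem v2_difference_coarray_hole_free (E1 N2 : ℤ) (hE1 : 1 ≤ E1) (hN2 : 1 ≤ N2)
    (E2 : ℤ) (hE2 : E2 = 2 * E1 + N2 * (2 * E1 + 1))
    (V2 : Set ℤ)
    (hV2 : V2 = Set.Icc 0 (2 * E1) ∪
      {x | ∃ i, 1 ≤ i ∧ i ≤ N2 ∧ x = 2 * E1 + i * (2 * E1 + 1)}) :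
    {x : ℤ | ∃ a ∈ V2, ∃ b ∈ V2, x = a - b} = Set.Icc (-E2) E2 := by
  subst hV2
  have bounds : ∀ a ∈ Set.Icc 0 (2 * E1) ∪
      {x | ∃ i, 1 ≤ i ∧ i ≤ N2 ∧ x = 2 * E1 + i * (2 * E1 + 1)}, 0 ≤ a ∧ a ≤ E2 := by
    rintro a (⟨h0, h1⟩ | ⟨i, h1, h2, rfl⟩)
    · exact ⟨h0, by nlinarith⟩
    · exact ⟨by nlinarith, by nlinarith⟩
  have nonneg_diff : ∀ μ : ℤ, 0 ≤ μ → μ ≤ E2 → ∃ a ∈ Set.Icc 0 (2 * E1) ∪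
      {x | ∃ i, 1 ≤ i ∧ i ≤ N2 ∧ x = 2 * E1 + i * (2 * E1 + 1)}, ∃ b ∈ Set.Icc 0 (2 * E1) ∪
      {x | ∃ i, 1 ≤ i ∧ i ≤ N2 ∧ x = 2 * E1 + i * (2 * E1 + 1)}, μ = a - b := by
    intro μ h0 h1
    have hM : 0 < 2 * E1 + 1 := by linarith
    have hdiv := Int.mul_ediv_add_emod μ (2 * E1 + 1)
    have hr0 := Int.emod_nonneg μ hM.ne'
    have hr1 := Int.emod_lt_of_pos μ hM
    have hq0 : 0 ≤ μ / (2 * E1 + 1) := Int.ediv_nonneg h0 hM.le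
    have hq1 : μ / (2 * E1 + 1) ≤ N2 :=
      Int.lt_add_one_iff.mp (Int.ediv_lt_of_lt_mul hM (by linarith))
    refine ⟨2 * E1 + μ / (2 * E1 + 1) * (2 * E1 + 1), ?_,
      2 * E1 - μ % (2 * E1 + 1), Or.inl ⟨by linarith, by linarith⟩, by linarith⟩
    rcases hq0.eq_or_lt with hq | hq
    · left
      rw [← hq]
      constructor <;> linarith
    · exact Or.inr ⟨_, hq, hq1, rfl⟩
  ext μ
  constructor
  · rintro ⟨a, ha, b, hb, rfl⟩
    have := bounds a ha
    have := bounds b hb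
    constructor <;> linarith
  · rintro ⟨h0, h1⟩
    rcases le_total 0 μ with h | h
    · exact nonneg_diff μ h h1
    · obtain ⟨a, ha, b, hb, hab⟩ := nonneg_diff (-μ) (by linarith) (by linarith)
      exact ⟨b, hb, a, ha, by linarith⟩
end

section
/- Let E ≥ 1 and n ≥ 1 be integers, Ω = {−E, −E+1, …, E}, and T = {2iE : 1 ≤ i ≤ n}. Then Ω ∪ {ω − t : ω ∈ Ω, t ∈ T} ∪ {t − ω : ω ∈ Ω, t ∈ T} = {μ ∈ ℤ : −(2n+1)E ≤ μ ≤ (2n+1)E}; consequently the difference co-array of Ω ∪ T equals the full hole-free range {a − b : a, b ∈ Ω ∪ T} = {μ ∈ ℤ : −(2n+1)E ≤ μ ≤ (2n+1)E}. -/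
/-- Every integer in `(E, (2n+1)E]` lies within distance `E` of some `2iE` with `1 ≤ i ≤ n`. -/
theorem exists_two_mul_mul_near {E n x : ℤ} (hE : 1 ≤ E) (hx : E < x)
    (hxn : x ≤ (2 * n + 1) * E) :
    ∃ i, 1 ≤ i ∧ i ≤ n ∧ 2 * i * E - E ≤ x ∧ x ≤ 2 * i * E + E := by
  have hpos : 0 < 2 * E := by linarith
  have h₁ := Int.mul_ediv_add_emod (x + E - 1) (2 * E)
  have h₂ := Int.emod_nonneg (x + E - 1) hpos.ne'
  have h₃ := Int.emod_lt_of_pos (x + E - 1) hpos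
  refine ⟨(x + E - 1) / (2 * E), ?_, ?_, ?_, ?_⟩
  · exact (Int.le_ediv_iff_mul_le hpos).2 (by linarith)
  · exact Int.lt_add_one_iff.1 ((Int.ediv_lt_iff_lt_mul hpos).2 (by linarith))
  · linarith
  · linarith

/-- For `Ω = {−E,…,E}` and `T = {2iE : 1 ≤ i ≤ n}`, the set
`Ω ∪ (Ω − T) ∪ (T − Ω)` is the full interval `{−(2n+1)E,…,(2n+1)E}`, and consequently the
difference co-array of `Ω ∪ T` equals this full hole-free range. -/
theorem ula_extension_difference_coarray (E n : ℤ) (hE : 1 ≤ E) (hn : 1 ≤ n)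
    (Ω T : Set ℤ) (hΩ : Ω = Set.Icc (-E) E)
    (hT : T = {x | ∃ i, 1 ≤ i ∧ i ≤ n ∧ x = 2 * i * E}) :
    (Ω ∪ {x : ℤ | ∃ ω ∈ Ω, ∃ t ∈ T, x = ω - t} ∪ {x : ℤ | ∃ ω ∈ Ω, ∃ t ∈ T, x = t - ω} =
        Set.Icc (-((2 * n + 1) * E)) ((2 * n + 1) * E)) ∧
    {x : ℤ | ∃ a ∈ Ω ∪ T, ∃ b ∈ Ω ∪ T, x = a - b} =
        Set.Icc (-((2 * n + 1) * E)) ((2 * n + 1) * E) := by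
  subst hΩ hT
  have hcover : ∀ x ∈ Set.Icc (-((2 * n + 1) * E)) ((2 * n + 1) * E),
      x ∈ Set.Icc (-E) E ∨ ∃ ω ∈ Set.Icc (-E) E, ∃ i, 1 ≤ i ∧ i ≤ n ∧
        (x = ω - 2 * i * E ∨ x = 2 * i * E - ω) := by
    rintro x ⟨hl, hu⟩
    rcases lt_or_ge E x with h | h
    · obtain ⟨i, h₁, h₂, h₃, h₄⟩ := exists_two_mul_mul_near hE h hu
      exact .inr ⟨2 * i * E - x, ⟨by linarith, by linarith⟩, i, h₁, h₂, .inr (by ring)⟩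
    rcases lt_or_ge x (-E) with h' | h'
    · obtain ⟨i, h₁, h₂, h₃, h₄⟩ :=
        exists_two_mul_mul_near (n := n) (x := -x) hE (by linarith) (by linarith)
      exact .inr ⟨x + 2 * i * E, ⟨by linarith, by linarith⟩, i, h₁, h₂, .inl (by ring)⟩
    · exact .inl ⟨h', h⟩
  have hnE : E ≤ n * E := le_mul_of_one_le_left (by linarith) hn
  have hmul : ∀ i, 1 ≤ i → i ≤ n → E ≤ i * E ∧ i * E ≤ n * E := fun i h₁ h₂ =>
    ⟨le_mul_of_one_le_left (by linarith) h₁, mul_le_mul_of_nonneg_right h₂ (by linarith)⟩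
  refine ⟨Set.Subset.antisymm ?_ fun x hx => ?_, Set.Subset.antisymm ?_ fun x hx => ?_⟩
  · rintro x ((⟨h₁, h₂⟩ | ⟨ω, ⟨h₁, h₂⟩, t, ⟨i, hi, hin, rfl⟩, rfl⟩) |
      ⟨ω, ⟨h₁, h₂⟩, t, ⟨i, hi, hin, rfl⟩, rfl⟩)
    · constructor <;> linarith
    all_goals
      obtain ⟨h₃, h₄⟩ := hmul i hi hin
      constructor <;> linarith
  · rcases hcover x hx with h | ⟨ω, hω, i, hi, hin, h | h⟩
    · exact .inl (.inl h)
    · exact .inl (.inr ⟨ω, hω, _, ⟨i, hi, hin, rfl⟩, h⟩)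
    · exact .inr ⟨ω, hω, _, ⟨i, hi, hin, rfl⟩, h⟩
  · have hbound : ∀ a ∈ Set.Icc (-E) E ∪ {x | ∃ i, 1 ≤ i ∧ i ≤ n ∧ x = 2 * i * E},
        -E ≤ a ∧ a ≤ 2 * (n * E) := by
      rintro a (⟨h₁, h₂⟩ | ⟨i, hi, hin, rfl⟩)
      · constructor <;> linarith
      · obtain ⟨h₃, h₄⟩ := hmul i hi hin
        constructor <;> linarith
    rintro x ⟨a, ha, b, hb, rfl⟩
    obtain ⟨ha₁, ha₂⟩ := hbound a ha
    obtain ⟨hb₁, hb₂⟩ := hbound b hb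
    constructor <;> linarith
  · rcases hcover x hx with h | ⟨ω, hω, i, hi, hin, h | h⟩
    · exact ⟨x, .inl h, 0, .inl ⟨by linarith, by linarith⟩, by ring⟩
    · exact ⟨ω, .inl hω, _, .inr ⟨i, hi, hin, rfl⟩, h⟩
    · exact ⟨_, .inr ⟨i, hi, hin, rfl⟩, ω, .inl hω, h⟩
end

section
/- Let N1 ≥ 3 be an integer and let r = ⌊(N1+1)/4⌋ (the nearest integer to (N1−1)/4). Then r and M2 = N1 − 2r satisfy r ≥ 0 and M2 ≥ 1, and for every integer m with m ≥ 0 and N1 − 2m ≥ 1, the CNA aperture satisfies −2m² + (N1−1)m + (N1−1) ≤ −2r² + (N1−1)r + (N1−1). In other words, among all splittings N1 = 2M1 + M2 of the CNA sensor budget, the aperture E1 = 2M1 + (M1+1)(M2−1) = −2M1² + (N1−1)M1 + N1 − 1 is maximized by choosing M1 = ⌊(N1+1)/4⌋ and M2 = N1 − 2M1. -/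
/-- Among all splittings `N1 = 2M1 + M2` of the CNA sensor budget, the aperture
`E1 = −2M1² + (N1−1)M1 + N1 − 1` is maximized by `M1 = ⌊(N1+1)/4⌋`, `M2 = N1 − 2M1`. -/
theorem cna_aperture_maximized (N1 : ℤ) (hN1 : 3 ≤ N1) (r : ℤ) (hr : r = (N1 + 1) / 4) :
    0 ≤ r ∧ 1 ≤ N1 - 2 * r ∧
    ∀ m : ℤ, 0 ≤ m → 1 ≤ N1 - 2 * m →
      -2 * m ^ 2 + (N1 - 1) * m + (N1 - 1) ≤ -2 * r ^ 2 + (N1 - 1) * r + (N1 - 1) := by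
  refine ⟨by lia, by lia, fun m _ _ => ?_⟩
  have key : 0 ≤ (r - m) * (N1 - 1 - 2 * (r + m)) := by
    rcases lt_trichotomy m r with h | h | h
    · exact mul_nonneg (by lia) (by lia)
    · simp [h]
    · exact mul_nonneg_of_nonpos_of_nonpos (by lia) (by lia)
  linarith
end

section
/- Let E1 ≥ 1 be an integer; let m ≥ 2 be an even integer, and define f(n) = 2(2n+1)(2E1 + (m−n)(2E1+1)) + 1 for n ∈ ℤ. Then for every integer n, f(n) ≤ f(m/2). In particular, among all splittings m = N2 + N3 with N2, N3 ≥ 1 of the remaining sensors of the FOGNA, the degrees of freedom 2(2N3+1)(2E1 + N2(2E1+1)) + 1 are maximized by N3 = m/2 = ⌊(2m+1)/4⌋ and N2 = m/2 = ⌈(2m−1)/4⌉. -/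
/-- For even `m ≥ 2` and `f(n) = 2(2n+1)(2E1 + (m−n)(2E1+1)) + 1`, the integer maximum of f
is attained at `n = m/2`; i.e. the DOF of FOGNA are maximized by `N3 = m/2`, `N2 = m/2`. -/
theorem dof_integer_maximum (E1 m : ℤ) (hE1 : 1 ≤ E1) (hm : 2 ≤ m) (hmeven : Even m)
    (f : ℤ → ℤ)
    (hf : ∀ n : ℤ, f n = 2 * (2 * n + 1) * (2 * E1 + (m - n) * (2 * E1 + 1)) + 1) :
    ∀ n : ℤ, f n ≤ f (m / 2) := by
  intro n
  obtain ⟨k, rfl⟩ := hmeven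
  have hk : (k + k) / 2 = k := by omega
  rw [hk, hf, hf]
  have hd : 0 ≤ (n - k) ^ 2 - (n - k) := sub_nonneg.mpr (Int.le_self_sq _)
  have h₁ : 0 ≤ (2 * E1 - 1) * ((n - k) ^ 2 - (n - k)) := mul_nonneg (by linarith) hd
  have h₂ : 0 ≤ (2 * E1 + 3) * (n - k) ^ 2 := mul_nonneg (by linarith) (sq_nonneg _)
  linarith
end

section
/- Let S = {0, 1, 3, 5, 6, 25, 38, 51, 102, 204, 306} ⊆ ℤ (the FOGNA with N = 11 sensors, obtained from N1 = 5, N2 = 3, N3 = 3, M1 = 1, M2 = 3, E1 = 6, E2 = 51). Then every integer μ with |μ| ≤ 357 belongs to Φ^u(S) = Φ1(S) ∪ Φ2(S) ∪ Φ3(S); hence the FOECA of this FOGNA contains the 715 consecutive lags {−357, …, 357}. -/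
/-- The dense block `{0, 1, 3, 5, 6}` of the array has pairwise sums `0, …, 12`. -/
theorem exists_add_eq_of_le_twelve {t : ℤ} (h0 : 0 ≤ t) (h12 : t ≤ 12) :
    ∃ a ∈ ({0, 1, 3, 5, 6} : Set ℤ), ∃ b ∈ ({0, 1, 3, 5, 6} : Set ℤ), t = a + b := by
  suffices h : ∀ t ∈ Finset.Icc (0 : ℤ) 12, ∃ a ∈ ({0, 1, 3, 5, 6} : Finset ℤ),
      ∃ b ∈ ({0, 1, 3, 5, 6} : Finset ℤ), t = a + b by
    simpa using h t (Finset.mem_Icc.mpr ⟨h0, h12⟩)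
  decide

/-- The translates of `[0, 12]` by `p - q` and of `[-12, 0]` by `p + q` cover `[0, 357]`. -/
theorem exists_near_add_or_sub {μ : ℤ} (h0 : 0 ≤ μ) (h : μ ≤ 357) :
    ∃ p ∈ ({0, 51, 102, 204, 306} : Set ℤ), ∃ q ∈ ({0, 25, 38, 51} : Set ℤ),
      (0 ≤ p + q - μ ∧ p + q - μ ≤ 12) ∨ (0 ≤ μ - (p - q) ∧ μ - (p - q) ≤ 12) := by
  simp only [Set.mem_insert_iff, Set.mem_singleton_iff, exists_eq_or_imp, exists_eq_left]
  omega

theorem mem_PhiU_fogna11_of_nonneg {μ : ℤ} (h0 : 0 ≤ μ) (h : μ ≤ 357) :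
    μ ∈ PhiU ({0, 1, 3, 5, 6, 25, 38, 51, 102, 204, 306} : Set ℤ) := by
  set S : Set ℤ := {0, 1, 3, 5, 6, 25, 38, 51, 102, 204, 306} with hS
  have hdense : ({0, 1, 3, 5, 6} : Set ℤ) ⊆ S := by simp [hS, Set.insert_subset_iff]
  have hsparse : ({0, 51, 102, 204, 306} : Set ℤ) ⊆ S := by simp [hS, Set.insert_subset_iff]
  have hshift : ({0, 25, 38, 51} : Set ℤ) ⊆ S := by simp [hS, Set.insert_subset_iff]
  obtain ⟨p, hp, q, hq, ⟨hl, hu⟩ | ⟨hl, hu⟩⟩ := exists_near_add_or_sub h0 h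
  all_goals obtain ⟨a, ha, b, hb, hab⟩ := exists_add_eq_of_le_twelve hl hu
  · exact Or.inl (Or.inr ⟨p, hsparse hp, a, hdense ha, q, hshift hq, b, hdense hb, by omega⟩)
  · exact Or.inl (Or.inl ⟨a, hdense ha, b, hdense hb, p, hsparse hp, q, hshift hq, by omega⟩)

/-- For the 11-sensor FOGNA `S = {0,1,3,5,6,25,38,51,102,204,306}`, every integer μ with
`|μ| ≤ 357` belongs to Φ^u(S): the FOECA contains the 715 consecutive lags {−357,…,357}. -/
theorem fogna11_foeca_lags :
    ∀ μ : ℤ, |μ| ≤ 357 →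
      μ ∈ PhiU ({0, 1, 3, 5, 6, 25, 38, 51, 102, 204, 306} : Set ℤ) := by
  intro μ hμ
  obtain ⟨hl, hu⟩ := abs_le.mp hμ
  rcases le_total 0 μ with h0 | h0
  · exact mem_PhiU_fogna11_of_nonneg h0 hu
  · simpa using neg_mem_PhiU (mem_PhiU_fogna11_of_nonneg (μ := -μ) (by omega) (by omega))
end
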